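/- Let N ≥ 3 and let u : ℝ^N → ℝ be a C² function with ∫_{ℝ^N} |∇u|² dx < ∞ and ∫_{ℝ^N} |u|^{2*} dx < ∞ which satisfies −Δu(x) = N(N−2)(1+|x|²)^{−2} u(x) for all x ∈ ℝ^N. Then there exists d ∈ ℝ such that u(x) = d · z_0(x) for all x ∈ ℝ^N; in other words, the space of such solutions is one-dimensional, spanned by z_0. -/

import Mathlib

open MeasureTheory Complex Filter

noncomputable section

/-- The `j`-th standard basis vector of `ℝ^N`. -/
def basis (N : ℕ) (j : Fin N) : EuclideanSpace ℝ (Fin N) := EuclideanSpace.single j 1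

/-- The standard bubble `z_{μ,ξ}`; `z_0 = bubble N 1 0`. -/
def bubble (N : ℕ) (μ : ℝ) (ξ x : EuclideanSpace ℝ (Fin N)) : ℝ :=
  ((N : ℝ) * ((N : ℝ) - 2)) ^ (((N : ℝ) - 2) / 4) * μ ^ (((N : ℝ) - 2) / 2) /
    (μ ^ 2 + ‖x - ξ‖ ^ 2) ^ (((N : ℝ) - 2) / 2)

/-- The Laplacian on `ℝ^N`: the sum of the second partial derivatives. -/
def lapR (N : ℕ) (f : EuclideanSpace ℝ (Fin N) → ℝ) (x : EuclideanSpace ℝ (Fin N)) : ℝ :=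
  ∑ j : Fin N, fderiv ℝ (fun y => fderiv ℝ f y (basis N j)) x (basis N j)

lemma lapR_one_add_norm_sq_rpow (N : ℕ) (x : EuclideanSpace ℝ (Fin N)) :
    lapR N (fun y => (1 + ‖y‖ ^ 2) ^ (-(((N : ℝ) - 2) / 2))) x =
      -((N : ℝ) * ((N : ℝ) - 2) * (1 + ‖x‖ ^ 2) ^ (-(2 : ℝ)) *
        (1 + ‖x‖ ^ 2) ^ (-(((N : ℝ) - 2) / 2))) := by
  have hpos : ∀ y : EuclideanSpace ℝ (Fin N), 0 < 1 + ‖y‖ ^ 2 := fun y => by positivity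
  have hd : ∀ (b : ℝ) (y : EuclideanSpace ℝ (Fin N)),
      HasFDerivAt (fun y : EuclideanSpace ℝ (Fin N) => (1 + ‖y‖ ^ 2) ^ b)
        ((b * (1 + ‖y‖ ^ 2) ^ (b - 1)) • (2 • innerSL ℝ y)) y := fun b y =>
    (((hasStrictFDerivAt_norm_sq y).hasFDerivAt.const_add 1).rpow_const
      (Or.inl (hpos y).ne'))
  have hin : ∀ (y : EuclideanSpace ℝ (Fin N)) j, inner ℝ y (basis N j) = y j := fun y j => by
    simp [basis, EuclideanSpace.inner_single_right]
  set a : ℝ := ((N : ℝ) - 2) / 2 with ha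
  have h1 : ∀ j, (fun y : EuclideanSpace ℝ (Fin N) =>
      fderiv ℝ (fun y => (1 + ‖y‖ ^ 2) ^ (-a)) y (basis N j)) =
      fun y => (-2 * a) * ((1 + ‖y‖ ^ 2) ^ (-a - 1) * y j) := by
    intro j
    funext y
    rw [(hd (-a) y).fderiv]
    simp [hin]
    ring
  have h2 : ∀ j, fderiv ℝ (fun y : EuclideanSpace ℝ (Fin N) =>
      (-2 * a) * ((1 + ‖y‖ ^ 2) ^ (-a - 1) * y j)) x (basis N j) =
      4 * a * (a + 1) * (1 + ‖x‖ ^ 2) ^ (-a - 1 - 1) * x j ^ 2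
        - 2 * a * (1 + ‖x‖ ^ 2) ^ (-a - 1) := by
    intro j
    have hp : HasFDerivAt (fun y : EuclideanSpace ℝ (Fin N) => y j)
        (EuclideanSpace.proj j : EuclideanSpace ℝ (Fin N) →L[ℝ] ℝ) x :=
      (EuclideanSpace.proj j : EuclideanSpace ℝ (Fin N) →L[ℝ] ℝ).hasFDerivAt
    rw [(((hd (-a - 1) x).fun_mul hp).const_mul (-2 * a)).fderiv]
    simp [hin]
    simp [basis]
    ring
  have hr : ∑ j, x j ^ 2 = ‖x‖ ^ 2 := by
    rw [EuclideanSpace.norm_sq_eq]; simp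
  have hN : (N : ℝ) = 2 * a + 2 := by rw [ha]; ring
  have e1 : (1 + ‖x‖ ^ 2) ^ (-a - 1) = (1 + ‖x‖ ^ 2) ^ (-a - 1 - 1) * (1 + ‖x‖ ^ 2) := by
    rw [Real.rpow_sub_one (hpos x).ne' (-a - 1)]
    field_simp [(hpos x).ne']
  have e2 : (1 + ‖x‖ ^ 2) ^ (-(2 : ℝ)) * (1 + ‖x‖ ^ 2) ^ (-a) =
      (1 + ‖x‖ ^ 2) ^ (-a - 1 - 1) := by
    rw [← Real.rpow_add (hpos x)]
    congr 1
    ring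
  unfold lapR
  simp_rw [h1, h2]
  rw [Finset.sum_sub_distrib, ← Finset.mul_sum, hr, e1, mul_assoc _ (_ ^ (-(2 : ℝ))), e2]
  simp
  rw [hN]
  ring

/-- Ground state substitution: integrating `div (φ² w J) = 0` for `J = z∇u - u∇z = z²∇w`. -/
lemma integral_sq_mul_grad_div_sq_le {N : ℕ} {u z φ V : EuclideanSpace ℝ (Fin N) → ℝ}
    (hu : ContDiff ℝ 2 u) (hz : ContDiff ℝ 2 z) (hz0 : ∀ x, z x ≠ 0)
    (hφ : ContDiff ℝ 1 φ) (hφc : HasCompactSupport φ)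
    (hlu : ∀ x, lapR N u x = V x * u x) (hlz : ∀ x, lapR N z x = V x * z x) :
    ∫ x, φ x ^ 2 * ∑ j, (z x * fderiv ℝ (fun y => u y / z y) x (basis N j)) ^ 2 ≤
      4 * ∫ x, u x ^ 2 * ∑ j, fderiv ℝ φ x (basis N j) ^ 2 := by
  have hw : ContDiff ℝ 2 (fun y => u y / z y) := hu.div hz hz0
  set w : EuclideanSpace ℝ (Fin N) → ℝ := fun y => u y / z y with hwdef
  have huw : ∀ x, u x = z x * w x := fun x => by simp only [hwdef]; field_simp [hz0 x]
  have D : ∀ {f : EuclideanSpace ℝ (Fin N) → ℝ}, ContDiff ℝ 2 f → ∀ j,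
      ContDiff ℝ 1 (fun x => fderiv ℝ f x (basis N j)) := fun hf j =>
    (hf.fderiv_right (m := 1) (by norm_num)).clm_apply contDiff_const
  have D0 : ∀ {f : EuclideanSpace ℝ (Fin N) → ℝ}, ContDiff ℝ 1 f → ∀ j,
      Continuous (fun x => fderiv ℝ f x (basis N j)) := fun hf j =>
    (hf.continuous_fderiv (by norm_num)).clm_apply continuous_const
  have hwd : Differentiable ℝ w := hw.differentiable (by norm_num)
  have hzd : Differentiable ℝ z := hz.differentiable (by norm_num)
  have hud : Differentiable ℝ u := hu.differentiable (by norm_num)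
  have hφd : Differentiable ℝ φ := hφ.differentiable (by norm_num)
  have hDu : ∀ x j, fderiv ℝ u x (basis N j) =
      z x * fderiv ℝ w x (basis N j) + w x * fderiv ℝ z x (basis N j) := by
    intro x j
    have : u = fun x => z x * w x := funext huw
    rw [this, fderiv_fun_mul (hzd x) (hwd x)]
    simp
  let J : Fin N → EuclideanSpace ℝ (Fin N) → ℝ := fun j x =>
    z x * fderiv ℝ u x (basis N j) - u x * fderiv ℝ z x (basis N j)
  have hJ1 : ∀ j, ContDiff ℝ 1 (J j) := fun j =>
    ((hz.of_le (by norm_num)).mul (D hu j)).sub ((hu.of_le (by norm_num)).mul (D hz j))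
  have hJ : ∀ j x, J j x = z x ^ 2 * fderiv ℝ w x (basis N j) := by
    intro j x
    simp only [J, hDu, huw x]
    ring
  have hdiv : ∀ x, ∑ j, fderiv ℝ (J j) x (basis N j) = 0 := by
    intro x
    have : ∀ j, fderiv ℝ (J j) x (basis N j) =
        z x * fderiv ℝ (fun y => fderiv ℝ u y (basis N j)) x (basis N j) -
        u x * fderiv ℝ (fun y => fderiv ℝ z y (basis N j)) x (basis N j) := by
      intro j
      have a1 := (D hu j).differentiable (by norm_num) x
      have a2 := (D hz j).differentiable (by norm_num) x
      simp only [J]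
      rw [fderiv_fun_sub ((hzd x).fun_mul a1) ((hud x).fun_mul a2), fderiv_fun_mul (hzd x) a1,
        fderiv_fun_mul (hud x) a2]
      simp
      ring
    simp_rw [this]
    rw [Finset.sum_sub_distrib, ← Finset.mul_sum, ← Finset.mul_sum]
    change z x * lapR N u x - u x * lapR N z x = 0
    rw [hlu, hlz]
    ring
  let f : EuclideanSpace ℝ (Fin N) → ℝ := fun x => φ x ^ 2 * w x
  have hf1 : ContDiff ℝ 1 f := (hφ.pow 2).mul (hw.of_le (by norm_num))
  have hφ2c : HasCompactSupport (fun x => φ x ^ 2) :=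
    hφc.comp_left (g := fun t : ℝ => t ^ 2) (by simp)
  have hfc : HasCompactSupport f := hφ2c.mul_right
  have hDf : ∀ j x, fderiv ℝ f x (basis N j) =
      φ x ^ 2 * fderiv ℝ w x (basis N j) + 2 * φ x * w x * fderiv ℝ φ x (basis N j) := by
    intro j x
    simp only [f]
    rw [fderiv_fun_mul ((hφd x).fun_pow 2) (hwd x), fderiv_fun_pow 2 (hφd x)]
    simp
    ring
  have i1 : ∀ j, Integrable (fun x => fderiv ℝ f x (basis N j) * J j x) := fun j =>
    ((D0 hf1 j).mul (hJ1 j).continuous).integrable_of_hasCompactSupport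
      ((hfc.fderiv_apply (𝕜 := ℝ) _).mul_right)
  have i2 : ∀ j, Integrable (fun x => f x * fderiv ℝ (J j) x (basis N j)) := fun j =>
    (hf1.continuous.mul (D0 (hJ1 j) j)).integrable_of_hasCompactSupport hfc.mul_right
  have hibp : ∑ j, ∫ x, fderiv ℝ f x (basis N j) * J j x = 0 := by
    have h : ∀ j, ∫ x, fderiv ℝ f x (basis N j) * J j x =
        -∫ x, f x * fderiv ℝ (J j) x (basis N j) := fun j => by
      rw [integral_mul_fderiv_eq_neg_fderiv_mul_of_integrable (i1 j) (i2 j)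
        ((hf1.continuous.mul (hJ1 j).continuous).integrable_of_hasCompactSupport hfc.mul_right)
        (fun x _ => hf1.differentiable (by norm_num) x)
        (fun x _ => (hJ1 j).differentiable (by norm_num) x), neg_neg]
    simp_rw [h]
    rw [Finset.sum_neg_distrib, ← integral_finsetSum _ (fun j _ => i2 j)]
    simp_rw [← Finset.mul_sum, hdiv]
    simp
  rw [← integral_finsetSum _ (fun j _ => i1 j)] at hibp
  set P : EuclideanSpace ℝ (Fin N) → ℝ := fun x =>
    φ x ^ 2 * ∑ j, (z x * fderiv ℝ w x (basis N j)) ^ 2 with hP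
  set Q : EuclideanSpace ℝ (Fin N) → ℝ := fun x => u x ^ 2 * ∑ j, fderiv ℝ φ x (basis N j) ^ 2
    with hQ
  have iP : Integrable P := by
    refine Continuous.integrable_of_hasCompactSupport ?_ hφ2c.mul_right
    exact (hφ.continuous.pow 2).mul (continuous_finsetSum _ fun j _ =>
      (hz.continuous.mul (D0 (hw.of_le (by norm_num)) j)).pow 2)
  have iQ : Integrable Q := by
    refine Continuous.integrable_of_hasCompactSupport ?_ ?_
    · exact (hu.continuous.pow 2).mul (continuous_finsetSum _ fun j _ => (D0 hφ j).pow 2)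
    · refine HasCompactSupport.mul_left ?_
      exact (hφc.fderiv (𝕜 := ℝ)).comp_left
        (g := fun L : EuclideanSpace ℝ (Fin N) →L[ℝ] ℝ => ∑ j, L (basis N j) ^ 2) (by simp)
  have hpt : ∀ x, (1 / 2) * P x - 2 * Q x ≤ ∑ j, fderiv ℝ f x (basis N j) * J j x := by
    intro x
    simp only [hP, hQ, Finset.mul_sum, ← Finset.sum_sub_distrib]
    refine Finset.sum_le_sum fun j _ => ?_
    rw [hDf, hJ, huw x]
    nlinarith [sq_nonneg (φ x * z x * fderiv ℝ w x (basis N j)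
      + 2 * (z x * w x * fderiv ℝ φ x (basis N j)))]
  have hle := integral_mono ((iP.const_mul (1 / 2)).sub (iQ.const_mul 2))
    (integrable_finsetSum _ fun j _ => i1 j) hpt
  simp only [Pi.sub_apply] at hle
  rw [integral_sub (iP.const_mul _) (iQ.const_mul _), integral_const_mul, integral_const_mul,
    hibp] at hle
  linarith

lemma norm_basis (N : ℕ) (j : Fin N) : ‖basis N j‖ = 1 := by simp [basis]

lemma exists_cutoff (E : Type*) [NormedAddCommGroup E] [InnerProductSpace ℝ E]
    [FiniteDimensional ℝ E] :
    ∃ η : E → ℝ, ContDiff ℝ 1 η ∧ HasCompactSupport η ∧ (∀ x, η x ^ 2 ≤ 1) ∧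
      (∀ x, ‖x‖ ≤ 1 → η x = 1) ∧ (∃ C, ∀ x, ‖fderiv ℝ η x‖ ≤ C) ∧ ∀ x, ‖x‖ < 1 ∨ 2 < ‖x‖ → fderiv ℝ η x = 0 := by
  let η : ContDiffBump (0 : E) := ⟨1, 2, one_pos, one_lt_two⟩
  have hη : ContDiff ℝ 1 (η : E → ℝ) := η.contDiff
  refine ⟨η, hη, η.hasCompactSupport, fun x => pow_le_one₀ η.nonneg η.le_one,
    fun x hx => ?_, ?_, ?_⟩
  · exact η.one_of_mem_closedBall (by simpa [η] using hx)
  · exact (hη.continuous_fderiv (by norm_num)).bounded_above_of_compact_support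
      (η.hasCompactSupport.fderiv (𝕜 := ℝ))
  · rintro x (hx | hx)
    · have : (η : E → ℝ) =ᶠ[nhds x] fun _ => 1 :=
        η.eventuallyEq_one_of_mem_ball (by simpa [η] using hx)
      rw [this.fderiv_eq]
      simp
    · refine fderiv_of_notMem_tsupport ℝ ?_
      rw [η.tsupport_eq]
      simpa [η] using hx

lemma sq_div_sq_le_rpow_add {N : ℕ} (hN : 3 ≤ N) (t : ℝ) {R l : ℝ} (hR : 0 < R) (hl : 0 < l) :
    t ^ 2 / R ^ 2 ≤ l ^ ((N : ℝ) / (N - 2)) * |t| ^ (2 * (N : ℝ) / (N - 2)) +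
      l ^ (-((N : ℝ) / 2)) * (R ^ N)⁻¹ := by
  have hN' : (3 : ℝ) ≤ N := by exact_mod_cast hN
  have hpq : ((N : ℝ) / (N - 2)).HolderConjugate ((N : ℝ) / 2) := by
    rw [Real.holderConjugate_iff]
    constructor
    · rw [lt_div_iff₀] <;> linarith
    · field_simp
      ring
  have h := Real.young_inequality_of_nonneg (a := l * t ^ 2) (b := l⁻¹ * (R ^ 2)⁻¹)
    (by positivity) (by positivity) hpq
  have e0 : l * t ^ 2 * (l⁻¹ * (R ^ 2)⁻¹) = t ^ 2 / R ^ 2 := by field_simp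
  have e1 : (l * t ^ 2) ^ ((N : ℝ) / (N - 2)) =
      l ^ ((N : ℝ) / (N - 2)) * |t| ^ (2 * (N : ℝ) / (N - 2)) := by
    rw [Real.mul_rpow hl.le (sq_nonneg t), ← sq_abs, ← Real.rpow_natCast_mul (abs_nonneg t)]
    congr 2
    push_cast
    ring
  have e2 : (l⁻¹ * (R ^ 2)⁻¹) ^ ((N : ℝ) / 2) = l ^ (-((N : ℝ) / 2)) * (R ^ N)⁻¹ := by
    rw [Real.mul_rpow (by positivity) (by positivity), Real.inv_rpow hl.le, ← Real.rpow_neg hl.le,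
      Real.inv_rpow (by positivity), ← Real.rpow_natCast_mul hR.le, ← Real.rpow_natCast R N]
    congr 3
    push_cast
    ring
  rw [e0, e1, e2] at h
  refine h.trans (add_le_add (div_le_self (by positivity) hpq.lt.le)
    (div_le_self (by positivity) hpq.symm.lt.le))

/-- The cutoff energy vanishes by Young's inequality, since the tail of `∫ |u|^{2^*}` does. -/
lemma eventually_integral_sq_mul_grad_cutoff_sq_lt {N : ℕ} (hN : 3 ≤ N)
    {u η : EuclideanSpace ℝ (Fin N) → ℝ}
    (hLp : Integrable (fun x => |u x| ^ (2 * (N : ℝ) / ((N : ℝ) - 2))))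
    {C : ℝ} (hC : ∀ x, ‖fderiv ℝ η x‖ ≤ C)
    (hsupp : ∀ x, ‖x‖ < 1 ∨ 2 < ‖x‖ → fderiv ℝ η x = 0) {ε : ℝ} (hε : 0 < ε) :
    ∀ᶠ n : ℕ in atTop, ∫ x, u x ^ 2 *
      ∑ j, fderiv ℝ (fun y => η (((n : ℝ) + 1)⁻¹ • y)) x (basis N j) ^ 2 < ε := by
  set p : ℝ := 2 * (N : ℝ) / ((N : ℝ) - 2) with hp
  set K : ℝ := N * C ^ 2 with hK
  have hK0 : 0 ≤ K := by positivity
  set ω : ℝ := volume.real (Metric.closedBall (0 : EuclideanSpace ℝ (Fin N)) 1) with hω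
  let S : ℕ → Set (EuclideanSpace ℝ (Fin N)) := fun n => {x | (n : ℝ) + 1 ≤ ‖x‖}
  have hS : ∀ n, MeasurableSet (S n) := fun n => measurableSet_le measurable_const measurable_norm
  have htail : Tendsto (fun n => ∫ x in S n, |u x| ^ p) atTop (nhds 0) := by
    have h := tendsto_setIntegral_of_antitone (μ := volume) (f := fun x => |u x| ^ p) hS
      (fun m n hmn x (hx : (n : ℝ) + 1 ≤ ‖x‖) => by
        have : (m : ℝ) ≤ n := by exact_mod_cast hmn
        exact (by linarith : (m : ℝ) + 1 ≤ ‖x‖)) ⟨0, hLp.integrableOn⟩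
    have hempty : ⋂ n, S n = ∅ := by
      refine Set.eq_empty_of_forall_notMem fun x hx => ?_
      obtain ⟨n, hn⟩ := exists_nat_gt ‖x‖
      have : (n : ℝ) + 1 ≤ ‖x‖ := Set.mem_iInter.1 hx n
      linarith
    simpa [hempty] using h
  obtain ⟨l, hl0, hl⟩ : ∃ l : ℝ, 0 < l ∧ K * 2 ^ N * ω * l ^ (-((N : ℝ) / 2)) < ε / 2 := by
    have h : Tendsto (fun l : ℝ => K * 2 ^ N * ω * l ^ (-((N : ℝ) / 2))) atTop (nhds 0) := by
      simpa using (tendsto_rpow_neg_atTop (y := (N : ℝ) / 2) (by positivity)).const_mul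
        (K * 2 ^ N * ω)
    exact ((eventually_gt_atTop 0).and (h.eventually_lt_const (half_pos hε))).exists
  have htail' : Tendsto (fun n => K * l ^ ((N : ℝ) / (N - 2)) * ∫ x in S n, |u x| ^ p)
      atTop (nhds 0) := by
    simpa using htail.const_mul (K * l ^ ((N : ℝ) / (N - 2)))
  filter_upwards [htail'.eventually_lt_const (half_pos hε)] with n hn
  set R : ℝ := (n : ℝ) + 1 with hRdef
  have hR : 0 < R := by positivity
  let B : Set (EuclideanSpace ℝ (Fin N)) := Metric.closedBall 0 (2 * R)
  let g : EuclideanSpace ℝ (Fin N) → ℝ := fun x =>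
    K * l ^ ((N : ℝ) / (N - 2)) * (S n).indicator (fun x => |u x| ^ p) x +
      B.indicator (fun _ => K * l ^ (-((N : ℝ) / 2)) * (R ^ N)⁻¹) x
  have hBfin : volume B ≠ ⊤ := (isCompact_closedBall _ _).measure_lt_top.ne
  have hBm : MeasurableSet B := Metric.isClosed_closedBall.measurableSet
  have ig1 := (hLp.indicator (hS n)).const_mul (K * l ^ ((N : ℝ) / (N - 2)))
  have ig2 : Integrable (B.indicator fun _ : EuclideanSpace ℝ (Fin N) =>
      K * l ^ (-((N : ℝ) / 2)) * (R ^ N)⁻¹) :=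
    (integrable_indicator_iff hBm).2 (integrableOn_const hBfin)
  have hB : volume.real B = (2 * R) ^ N * ω := by
    simp only [B, hω, measureReal_def]
    rw [Measure.addHaar_closedBall _ _ (by positivity), Measure.addHaar_closedBall _ _ zero_le_one]
    simp [ENNReal.toReal_ofReal hR.le, hR.le]
  have hg : ∫ x, g x = K * l ^ ((N : ℝ) / (N - 2)) * (∫ x in S n, |u x| ^ p) +
      K * 2 ^ N * ω * l ^ (-((N : ℝ) / 2)) := by
    simp only [g]
    rw [integral_add ig1 ig2, integral_const_mul, integral_indicator (hS n),
      integral_indicator hBm, setIntegral_const, hB, smul_eq_mul]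
    congr 1
    rw [mul_pow]
    field_simp
  have hpt : ∀ x, u x ^ 2 * ∑ j, fderiv ℝ (fun y => η (R⁻¹ • y)) x (basis N j) ^ 2 ≤ g x := by
    intro x
    have hfd : fderiv ℝ (fun y => η (R⁻¹ • y)) x = R⁻¹ • fderiv ℝ η (R⁻¹ • x) := by
      rw [fderiv_comp_smul]
    have hn : ‖R⁻¹ • x‖ = R⁻¹ * ‖x‖ := by
      rw [norm_smul, Real.norm_of_nonneg (by positivity)]
    by_cases hx : x ∈ S n ∧ x ∈ B
    · have h1 : ∀ j, fderiv ℝ (fun y => η (R⁻¹ • y)) x (basis N j) ^ 2 ≤ C ^ 2 / R ^ 2 := by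
        intro j
        have h := (fderiv ℝ η (R⁻¹ • x)).le_opNorm (basis N j)
        rw [norm_basis, mul_one, Real.norm_eq_abs] at h
        have h2 := sq_le_sq' (by linarith [neg_le_of_abs_le (h.trans (hC _))])
          ((le_abs_self _).trans (h.trans (hC _)))
        rw [hfd, _root_.smul_apply, smul_eq_mul, mul_pow, inv_pow, div_eq_inv_mul]
        gcongr
      have h2 : ∑ j, fderiv ℝ (fun y => η (R⁻¹ • y)) x (basis N j) ^ 2 ≤ K / R ^ 2 := by
        refine (Finset.sum_le_sum fun j _ => h1 j).trans_eq ?_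
        simp [hK, mul_div_assoc]
      simp only [g, Set.indicator_of_mem hx.1, Set.indicator_of_mem hx.2]
      calc u x ^ 2 * ∑ j, fderiv ℝ (fun y => η (R⁻¹ • y)) x (basis N j) ^ 2
          ≤ u x ^ 2 * (K / R ^ 2) := by gcongr
        _ = K * (u x ^ 2 / R ^ 2) := by ring
        _ ≤ K * _ := mul_le_mul_of_nonneg_left (sq_div_sq_le_rpow_add hN (u x) hR hl0) hK0
        _ = _ := by ring
    · have h0 : fderiv ℝ η (R⁻¹ • x) = 0 := by
        apply hsupp
        rw [hn]
        rcases not_and_or.1 hx with h | h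
        · left
          have : ‖x‖ < R := not_le.1 h
          rwa [inv_mul_lt_one₀ hR]
        · right
          have : 2 * R < ‖x‖ := by simpa [B] using h
          rwa [lt_inv_mul_iff₀ hR, mul_comm]
      rw [hfd, h0]
      simp only [smul_zero, _root_.zero_apply]
      simp only [ne_eq, OfNat.ofNat_ne_zero, not_false_eq_true, zero_pow,
        Finset.sum_const_zero, mul_zero]
      refine add_nonneg (mul_nonneg (by positivity) (Set.indicator_nonneg (fun _ _ => ?_) _))
        (Set.indicator_nonneg (fun _ _ => ?_) _) <;> positivity
  have hle : ∫ x, u x ^ 2 * ∑ j, fderiv ℝ (fun y => η (R⁻¹ • y)) x (basis N j) ^ 2 ≤ ∫ x, g x :=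
    integral_mono_of_nonneg (Eventually.of_forall fun x => by positivity) (ig1.add ig2)
      (Eventually.of_forall hpt)
  linarith

/-- A `C²` solution in `L^{2^*}` of `Δu = V u` is a multiple of any nowhere vanishing solution. -/
lemma eq_const_mul_of_lapR_eq {N : ℕ} (hN : 3 ≤ N) {u z V : EuclideanSpace ℝ (Fin N) → ℝ}
    (hu : ContDiff ℝ 2 u) (hz : ContDiff ℝ 2 z) (hz0 : ∀ x, z x ≠ 0)
    (hLp : Integrable (fun x => |u x| ^ (2 * (N : ℝ) / ((N : ℝ) - 2))))
    (hlu : ∀ x, lapR N u x = V x * u x) (hlz : ∀ x, lapR N z x = V x * z x) :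
    ∃ d : ℝ, ∀ x, u x = d * z x := by
  obtain ⟨η, hη, hηc, hη_le, hη1, ⟨C, hC⟩, hsupp⟩ := exists_cutoff (EuclideanSpace ℝ (Fin N))
  have hw : ContDiff ℝ 1 (fun y => u y / z y) := (hu.div hz hz0).of_le (by norm_num)
  let G : EuclideanSpace ℝ (Fin N) → ℝ := fun x =>
    ∑ j, (z x * fderiv ℝ (fun y => u y / z y) x (basis N j)) ^ 2
  have hG : Continuous G := continuous_finsetSum _ fun j _ =>
    (hz.continuous.mul ((hw.continuous_fderiv (by norm_num)).clm_apply continuous_const)).pow 2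
  have hG0 : ∀ x, 0 ≤ G x := fun x => Finset.sum_nonneg fun j _ => sq_nonneg _
  let φ : ℕ → EuclideanSpace ℝ (Fin N) → ℝ := fun n y => η (((n : ℝ) + 1)⁻¹ • y)
  have hφ : ∀ n, ContDiff ℝ 1 (φ n) := fun n => hη.comp (contDiff_const_smul _)
  have hφc : ∀ n, HasCompactSupport (φ n) := fun n => hηc.comp_smul (by positivity)
  have hφ2c : ∀ n, HasCompactSupport (fun x => φ n x ^ 2) := fun n =>
    (hφc n).comp_left (g := fun t : ℝ => t ^ 2) (by simp)
  have hφ1 : ∀ (n : ℕ) x, ‖x‖ ≤ (n : ℝ) + 1 → φ n x = 1 := by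
    intro n x hx
    apply hη1
    rw [norm_smul, Real.norm_of_nonneg (by positivity)]
    rwa [inv_mul_le_one₀ (by positivity)]
  have hcont : ∀ n, Continuous fun x => φ n x ^ 2 * G x := fun n =>
    ((hφ n).continuous.pow 2).mul hG
  have hG_zero : ∀ x, G x = 0 := by
    intro x₀
    by_contra hx₀
    obtain ⟨m, hm⟩ := exists_nat_gt ‖x₀‖
    have hpos : 0 < ∫ x, φ m x ^ 2 * G x := by
      refine (hcont m).integral_pos_of_hasCompactSupport_nonneg_nonzero (hφ2c m).mul_right
        (fun x => mul_nonneg (sq_nonneg _) (hG0 x)) (x := x₀) ?_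
      rw [hφ1 m x₀ (by linarith)]
      simpa using hx₀
    obtain ⟨r, hr⟩ := (hφc m).isCompact.isBounded.exists_norm_le
    obtain ⟨n, hn, hnr⟩ := ((eventually_integral_sq_mul_grad_cutoff_sq_lt hN hLp hC hsupp
      (div_pos hpos four_pos)).and
      (tendsto_natCast_atTop_atTop.eventually_ge_atTop r)).exists
    have hcac := integral_sq_mul_grad_div_sq_le hu hz hz0 (hφ n) (hφc n) hlu hlz
    have hmono : ∫ x, φ m x ^ 2 * G x ≤ ∫ x, φ n x ^ 2 * G x := by
      refine integral_mono ((hcont m).integrable_of_hasCompactSupport (hφ2c m).mul_right)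
        ((hcont n).integrable_of_hasCompactSupport (hφ2c n).mul_right) fun x => ?_
      by_cases hx : x ∈ tsupport (φ m)
      · have : ‖x‖ ≤ (n : ℝ) + 1 := by linarith [hr x hx]
        refine mul_le_mul_of_nonneg_right ?_ (hG0 x)
        simpa [hφ1 n x this] using hη_le (((m : ℝ) + 1)⁻¹ • x)
      · simp only [image_eq_zero_of_notMem_tsupport hx]
        simpa using mul_nonneg (sq_nonneg (φ n x)) (hG0 x)
    simp only [φ, G] at hcac hmono hn
    linarith
  have hfd : ∀ x, fderiv ℝ (fun y => u y / z y) x = 0 := by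
    intro x
    have h := (Finset.sum_eq_zero_iff_of_nonneg fun j _ => sq_nonneg _).1 (hG_zero x)
    have hj : ∀ j, fderiv ℝ (fun y => u y / z y) x (basis N j) = 0 := fun j => by
      simpa [hz0 x] using h j (Finset.mem_univ j)
    refine ContinuousLinearMap.coe_injective
      ((EuclideanSpace.basisFun (Fin N) ℝ).toBasis.ext fun j => ?_)
    simpa [basis] using hj j
  refine ⟨u 0 / z 0, fun x => ?_⟩
  rw [is_const_of_fderiv_eq_zero (hw.differentiable (by norm_num)) hfd 0 x]
  field_simp [hz0 x]

/-- The space of `C²` solutions of `-Δu = N(N-2)(1+|x|²)^{-2} u` with finite Dirichlet energy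
and finite `L^{2^*}` norm is one-dimensional, spanned by `z_0`. -/
theorem linearized_radial_kernel (N : ℕ) (hN : 3 ≤ N)
    (u : EuclideanSpace ℝ (Fin N) → ℝ) (hu : ContDiff ℝ 2 u)
    (hgrad : Integrable (fun x => ∑ j : Fin N, (fderiv ℝ u x (basis N j)) ^ 2))
    (hLp : Integrable (fun x => |u x| ^ (2 * (N : ℝ) / ((N : ℝ) - 2))))
    (heq : ∀ x, - lapR N u x = (N : ℝ) * ((N : ℝ) - 2) * (1 + ‖x‖ ^ 2) ^ (-(2 : ℝ)) * u x) :
    ∃ d : ℝ, ∀ x, u x = d * bubble N 1 0 x := by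
  have hN' : (3 : ℝ) ≤ N := by exact_mod_cast hN
  have hpos : ∀ y : EuclideanSpace ℝ (Fin N), 0 < 1 + ‖y‖ ^ 2 := fun y => by positivity
  obtain ⟨d, hd⟩ := eq_const_mul_of_lapR_eq hN hu
    (z := fun y => (1 + ‖y‖ ^ 2) ^ (-(((N : ℝ) - 2) / 2)))
    (V := fun x => -((N : ℝ) * ((N : ℝ) - 2) * (1 + ‖x‖ ^ 2) ^ (-(2 : ℝ))))
    ((contDiff_const.add (contDiff_norm_sq ℝ)).rpow_const_of_ne fun x => (hpos x).ne')
    (fun x => (Real.rpow_pos_of_pos (hpos x) _).ne') hLp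
    (fun x => by linarith [heq x])
    (fun x => by rw [lapR_one_add_norm_sq_rpow, neg_mul])
  have hκ : ((N : ℝ) * ((N : ℝ) - 2)) ^ (((N : ℝ) - 2) / 4) ≠ 0 :=
    (Real.rpow_pos_of_pos (mul_pos (by linarith) (by linarith)) _).ne'
  refine ⟨d / ((N : ℝ) * ((N : ℝ) - 2)) ^ (((N : ℝ) - 2) / 4), fun x => ?_⟩
  rw [hd x, bubble, Real.rpow_neg (hpos x).le]
  simp only [sub_zero, Real.one_rpow, one_pow, mul_one]
  field_simp
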